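/- Let N be a strictly convex (possibly non-smooth) norm on ℝ^{2n} and let γ=(γ₁,…,γ_{2n+1}):ℝ→ℍⁿ be an infinite geodesic with respect to the sub-Finsler metric d_SF associated to N. Assume γ is not a horizontal line. Then there exists a constant C>0 such that ‖(γ₁(s),…,γ_{2n}(s))‖ ≤ C for all s∈ℝ, where ‖·‖ is the Euclidean norm. -/

import Mathlib

open MeasureTheory Set

noncomputable section

/-- `ℝ^{2n}`, with the Euclidean norm. -/
abbrev V (n : ℕ) := EuclideanSpace ℝ (Fin (2 * n))

/-- The `n`-th Heisenberg group as a set: `ℝ^{2n} × ℝ`. -/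
abbrev Heis (n : ℕ) := V n × ℝ

/-- Euclidean dot product on `ℝ^{2n}`. -/
def dot {n : ℕ} (p z : V n) : ℝ := ∑ i, p i * z i

/-- Index `i` as an element of the first half of `Fin (2n)`. -/
def fstIdx {n : ℕ} (i : Fin n) : Fin (2 * n) := ⟨i.1, by have := i.isLt; omega⟩

/-- Index `n + i` as an element of the second half of `Fin (2n)`. -/
def sndIdx {n : ℕ} (i : Fin n) : Fin (2 * n) := ⟨n + i.1, by have := i.isLt; omega⟩

/-- The symplectic form `⟨z, J_n z'⟩ = ∑ (y_i x'_i - x_i y'_i)` on `ℝ^{2n}`. -/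
def symp {n : ℕ} (z z' : V n) : ℝ :=
  ∑ i : Fin n, (z (sndIdx i) * z' (fstIdx i) - z (fstIdx i) * z' (sndIdx i))

/-- Heisenberg group multiplication. -/
def hmul {n : ℕ} (g g' : Heis n) : Heis n :=
  (g.1 + g'.1, g.2 + g'.2 + 2 * symp g.1 g'.1)

/-- Heisenberg group inverse. -/
def hinv {n : ℕ} (g : Heis n) : Heis n := (-g.1, -g.2)

/-- Heisenberg dilation `δ_λ(z,t) = (λ z, λ² t)`. -/
def dil {n : ℕ} (l : ℝ) (g : Heis n) : Heis n := (l • g.1, l ^ 2 * g.2)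

/-- `N : ℝ^{2n} → ℝ` is a norm. -/
structure IsNorm {n : ℕ} (N : V n → ℝ) : Prop where
  nonneg : ∀ z, 0 ≤ N z
  eq_zero_iff : ∀ z, N z = 0 ↔ z = 0
  smul : ∀ (a : ℝ) (z : V n), N (a • z) = |a| * N z
  triangle : ∀ z z', N (z + z') ≤ N z + N z'

/-- `N` is a strictly convex norm: additivity of the norm forces positive collinearity. -/
def StrictlyConvexNorm {n : ℕ} (N : V n → ℝ) : Prop :=
  ∀ z z' : V n, z ≠ 0 → z' ≠ 0 → N (z + z') = N z + N z' →
    ∃ α : ℝ, 0 < α ∧ z' = α • z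

/-- The subdifferential of `f : ℝ^{2n} → ℝ` at `z`. -/
def subdiff {n : ℕ} (f : V n → ℝ) (z : V n) : Set (V n) :=
  {p | ∀ z', f z + dot p (z' - z) ≤ f z'}

/-- A norm is smooth if its subdifferential is a singleton away from the origin. -/
def SmoothNorm {n : ℕ} (N : V n → ℝ) : Prop :=
  ∀ z : V n, z ≠ 0 → ∃ p : V n, subdiff N z = {p}

/-- The dual norm `N_*(p) = sup { p·z : N(z) = 1 }`. -/
def dualN {n : ℕ} (N : V n → ℝ) (p : V n) : ℝ :=
  sSup ((fun z => dot p z) '' {z | N z = 1})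

/-- `F_N(z) = ½ N(z)²`. -/
def FN {n : ℕ} (N : V n → ℝ) (z : V n) : ℝ := (1 / 2) * (N z) ^ 2

/-- The Legendre transform `f*(p) = sup_z (p·z - f(z))`. -/
def legendre {n : ℕ} (f : V n → ℝ) (p : V n) : ℝ :=
  ⨆ z : V n, (dot p z - f z)

/-- A horizontal (absolutely continuous) curve on `[a,b]`, encoded via an integrable
horizontal velocity `v = γ̇_I` together with the integral form of the horizontality
condition for the last coordinate. -/
structure HorizCurve (n : ℕ) (a b : ℝ) where
  γ : ℝ → Heis n
  v : ℝ → V n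
  intg : IntegrableOn v (Icc a b)
  pos : ∀ s ∈ Icc a b, (γ s).1 = (γ a).1 + ∫ u in a..s, v u
  vert : ∀ s ∈ Icc a b, (γ s).2 = (γ a).2 + ∫ u in a..s, 2 * symp ((γ u).1) (v u)

/-- The sub-Finsler distance associated to the norm `N` on `ℍⁿ`. -/
def dSF (n : ℕ) (N : V n → ℝ) (g g' : Heis n) : ℝ :=
  sInf { L | ∃ (a b : ℝ) (c : HorizCurve n a b), a ≤ b ∧ c.γ a = g ∧ c.γ b = g' ∧
    L = ∫ s in a..b, N (c.v s) }

/-- Horizontal projection of the trajectory of the control `v`,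
solving `γ̇_I = -v`, `γ_I(0) = 0`. -/
def trajI (n : ℕ) (v : ℝ → V n) (s : ℝ) : V n := -∫ u in (0:ℝ)..s, v u

/-- The trajectory of the control `v`: solves `ẋ_i = -v_i`, `ẏ_i = -v_{n+i}`,
`ṫ = -2∑(y_i v_i - x_i v_{n+i})`, starting at the neutral element. -/
def traj (n : ℕ) (v : ℝ → V n) (s : ℝ) : Heis n :=
  (trajI n v s, -∫ u in (0:ℝ)..s, 2 * symp (trajI n v u) (v u))

/-- `v` is an admissible control steering `e` to `g` in time `T`. -/
def Admissible (n : ℕ) (T : ℝ) (g : Heis n) (v : ℝ → V n) : Prop :=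
  IntegrableOn v (Icc 0 T) ∧ traj n v T = g

/-- `v` is optimal for the energy problem (P). -/
def OptimalEnergy (n : ℕ) (N : V n → ℝ) (T : ℝ) (g : Heis n) (v : ℝ → V n) : Prop :=
  Admissible n T g v ∧ ∀ w : ℝ → V n, Admissible n T g w →
    (∫ s in (0:ℝ)..T, FN N (v s)) ≤ ∫ s in (0:ℝ)..T, FN N (w s)

/-- `v` is optimal for the length problem. -/
def OptimalLength (n : ℕ) (N : V n → ℝ) (T : ℝ) (g : Heis n) (v : ℝ → V n) : Prop :=
  Admissible n T g v ∧ ∀ w : ℝ → V n, Admissible n T g w →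
    (∫ s in (0:ℝ)..T, N (v s)) ≤ ∫ s in (0:ℝ)..T, N (w s)

/-- The standard symplectic matrix `J_n` acting on `ℝ^{2n}`:
`(J z)_i = -z_{n+i}`, `(J z)_{n+i} = z_i`. -/
def Jmat (n : ℕ) (z : V n) : V n :=
  (EuclideanSpace.equiv (Fin (2 * n)) ℝ).symm
    (fun j => if h : (j : ℕ) < n then -z ⟨n + (j : ℕ), by have := j.isLt; omega⟩
      else z ⟨(j : ℕ) - n, by have := j.isLt; omega⟩)

/-- The function `a` associated to a multiplier `λ` (with `λ_{2n+1} ≡ k`) and a control `v`: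
`a_i = λ_i + 2k y_i`, `a_{n+i} = λ_{n+i} - 2k x_i`, where `(x,y) = γ_I` is the horizontal
projection of the trajectory of `v`. -/
def afun (n : ℕ) (v : ℝ → V n) (lam : ℝ → V n) (k : ℝ) (s : ℝ) : V n :=
  lam s - (2 * k) • Jmat n (trajI n v s)

/-- A Pontryagin multiplier `(λ₀, λ)` for the control `v` on `[0,T]` for problem (P):
`λ = (λ_I, k)` with `λ_{2n+1} ≡ k` constant, `λ̇_i = -2k v_{n+i}`, `λ̇_{n+i} = 2k v_i`
(in integrated form), nontriviality, the pointwise minimum principle, and constancy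
of the minimized Hamiltonian. -/
structure PMP (n : ℕ) (N : V n → ℝ) (T : ℝ) (v : ℝ → V n) (l0 : ℝ) where
  lam : ℝ → V n
  k : ℝ
  lam_eq : ∀ s ∈ Icc (0:ℝ) T,
    lam s = lam 0 + (2 * k) • ∫ u in (0:ℝ)..s, Jmat n (v u)
  nontriv : ¬(l0 = 0 ∧ k = 0 ∧ lam 0 = 0)
  argmin : ∀ s ∈ Icc (0:ℝ) T, ∀ u : V n,
    l0 * FN N (v s) - dot (afun n v lam k s) (v s) ≤ l0 * FN N u - dot (afun n v lam k s) u
  isConst : ∃ c : ℝ, ∀ s ∈ Icc (0:ℝ) T,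
    l0 * FN N (v s) - dot (afun n v lam k s) (v s) = c

/-- A homogeneous norm on the Heisenberg group `ℍⁿ`. -/
structure IsHomNorm {n : ℕ} (Nh : Heis n → ℝ) : Prop where
  nonneg : ∀ g, 0 ≤ Nh g
  eq_zero_iff : ∀ g, Nh g = 0 ↔ g = ((0 : V n), (0 : ℝ))
  symm : ∀ g, Nh (hinv g) = Nh g
  triangle : ∀ g g', Nh (hmul g g') ≤ Nh g + Nh g'
  homog : ∀ l : ℝ, 0 < l → ∀ g, Nh (dil l g) = l * Nh g

/-- The geodesic linearity property: every infinite geodesic of `(ℍⁿ, d)` is an affine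
line in `ℝ^{2n+1}`. -/
def GLP (n : ℕ) (d : Heis n → Heis n → ℝ) : Prop :=
  ∀ γ : ℝ → Heis n, (∀ s s' : ℝ, d (γ s) (γ s') = |s - s'|) →
    ∃ p u : Heis n, ∀ s : ℝ, γ s = p + s • u

/-- An infinite multiplier for the control `v` on `[0,∞)`. -/
def IsInfMult (n : ℕ) (N : V n → ℝ) (v : ℝ → V n) (lam : ℝ → V n) (k : ℝ) : Prop :=
  ∀ T : ℝ, 0 < T → ∃ m : PMP n N T v 1, m.lam = lam ∧ m.k = k

section Symplectic

variable {n : ℕ}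

/-- The symplectic form as a bilinear map. -/
def sympL (n : ℕ) : V n →ₗ[ℝ] V n →ₗ[ℝ] ℝ :=
  LinearMap.mk₂ ℝ symp
    (fun _ _ _ => by
      simp only [symp, PiLp.add_apply, ← Finset.sum_add_distrib]
      exact Finset.sum_congr rfl fun _ _ => by ring)
    (fun _ _ _ => by
      simp only [symp, PiLp.smul_apply, smul_eq_mul, Finset.mul_sum]
      exact Finset.sum_congr rfl fun _ _ => by ring)
    (fun _ _ _ => by
      simp only [symp, PiLp.add_apply, ← Finset.sum_add_distrib]
      exact Finset.sum_congr rfl fun _ _ => by ring)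
    (fun _ _ _ => by
      simp only [symp, PiLp.smul_apply, smul_eq_mul, Finset.mul_sum]
      exact Finset.sum_congr rfl fun _ _ => by ring)

lemma symp_add_left (x y z : V n) : symp (x + y) z = symp x z + symp y z :=
  (sympL n).map_add₂ x y z

lemma symp_add_right (x y z : V n) : symp x (y + z) = symp x y + symp x z :=
  ((sympL n) x).map_add y z

lemma symp_neg_left (x y : V n) : symp (-x) y = -symp x y :=
  (sympL n).map_neg₂ x y

lemma symp_neg_right (x y : V n) : symp x (-y) = -symp x y :=
  ((sympL n) x).map_neg y

lemma symp_smul_left (a : ℝ) (x y : V n) : symp (a • x) y = a * symp x y :=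
  (sympL n).map_smul₂ a x y

lemma symp_smul_right (a : ℝ) (x y : V n) : symp x (a • y) = a * symp x y :=
  ((sympL n) x).map_smul a y

lemma symp_zero_right (x : V n) : symp x 0 = 0 :=
  ((sympL n) x).map_zero

lemma symp_swap (x y : V n) : symp x y = -symp y x := by
  simp only [symp, ← Finset.sum_neg_distrib]
  exact Finset.sum_congr rfl fun _ _ => by ring

lemma symp_self (x : V n) : symp x x = 0 := by
  have := symp_swap x x
  linarith

lemma abs_symp_le (x y : V n) : |symp x y| ≤ n * (2 * (‖x‖ * ‖y‖)) := by
  have hc : ∀ (z : V n) i, |z i| ≤ ‖z‖ := fun z i => PiLp.norm_apply_le z i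
  calc |symp x y| ≤ ∑ i : Fin n,
        |x (sndIdx i) * y (fstIdx i) - x (fstIdx i) * y (sndIdx i)| :=
        Finset.abs_sum_le_sum_abs _ _
    _ ≤ ∑ _i : Fin n, 2 * (‖x‖ * ‖y‖) := by
        refine Finset.sum_le_sum fun i _ => (abs_sub _ _).trans ?_
        rw [abs_mul, abs_mul]
        have h1 := mul_le_mul (hc x (sndIdx i)) (hc y (fstIdx i)) (abs_nonneg _) (norm_nonneg _)
        have h2 := mul_le_mul (hc x (fstIdx i)) (hc y (sndIdx i)) (abs_nonneg _) (norm_nonneg _)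
        linarith
    _ = n * (2 * (‖x‖ * ‖y‖)) := by simp

/-- Pairing a vector symplectically with a suitable partner of the same norm yields the square
of its norm. -/
lemma exists_symp_eq_norm_sq (y : V n) : ∃ e : V n, ‖e‖ = ‖y‖ ∧ symp e y = ‖y‖ ^ 2 := by
  have hsum : ∀ f : Fin (2 * n) → ℝ,
      ∑ j, f j = ∑ i : Fin n, (f (fstIdx i) + f (sndIdx i)) := by
    intro f
    have h := Fin.sum_univ_add (fun j : Fin (n + n) => f (Fin.cast (two_mul n).symm j))
    rw [Finset.sum_add_distrib]
    refine Eq.trans ?_ h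
    exact (Equiv.sum_comp (finCongr (two_mul n).symm) f).symm
  refine ⟨WithLp.toLp 2 fun j => if h : (j : ℕ) < n then -y ⟨n + j, by omega⟩
      else y ⟨j - n, by omega⟩, ?_, ?_⟩
  · rw [EuclideanSpace.norm_eq, EuclideanSpace.norm_eq, hsum, hsum]
    congr 1
    refine Finset.sum_congr rfl fun i _ => ?_
    simp [fstIdx, sndIdx]
    ring
  · rw [EuclideanSpace.norm_sq_eq, hsum]
    refine Finset.sum_congr rfl fun i _ => ?_
    simp [fstIdx, sndIdx]
    ring

end Symplectic

section Norms

variable {n : ℕ} {N : V n → ℝ}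

lemma IsNorm.zero (hN : IsNorm N) : N 0 = 0 := (hN.eq_zero_iff 0).2 rfl

lemma IsNorm.neg (hN : IsNorm N) (z : V n) : N (-z) = N z := by
  simpa using hN.smul (-1) z

lemma IsNorm.convexOn (hN : IsNorm N) : ConvexOn ℝ univ N := by
  refine ⟨convex_univ, fun x _ y _ a b ha hb _ => ?_⟩
  simpa [hN.smul, abs_of_nonneg ha, abs_of_nonneg hb] using hN.triangle (a • x) (b • y)

lemma IsNorm.continuous (hN : IsNorm N) : Continuous N :=
  continuousOn_univ.1 (hN.convexOn.continuousOn isOpen_univ)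

/-- Any norm is equivalent to the Euclidean one. -/
lemma IsNorm.exists_equiv (hN : IsNorm N) :
    ∃ K : ℝ, 0 < K ∧ ∀ z : V n, ‖z‖ ≤ K * N z ∧ N z ≤ K * ‖z‖ := by
  rcases subsingleton_or_nontrivial (V n) with h | h
  · refine ⟨1, one_pos, fun z => ?_⟩
    rw [Subsingleton.elim z 0]
    simp [hN.zero]
  have hcomp : IsCompact (Metric.sphere (0 : V n) 1) := isCompact_sphere 0 1
  have hne : (Metric.sphere (0 : V n) 1).Nonempty := NormedSpace.sphere_nonempty.2 zero_le_one
  obtain ⟨a, ha, hamin⟩ := hcomp.exists_isMinOn hne hN.continuous.continuousOn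
  obtain ⟨b, hb, hbmax⟩ := hcomp.exists_isMaxOn hne hN.continuous.continuousOn
  have hpos : ∀ c ∈ Metric.sphere (0 : V n) 1, 0 < N c := fun c hc =>
    (hN.nonneg c).lt_of_ne fun h0 => by
      rw [(hN.eq_zero_iff c).1 h0.symm] at hc
      simp at hc
  have ha0 := hpos a ha
  have hb0 := hpos b hb
  refine ⟨(N a)⁻¹ + N b, by positivity, fun z => ?_⟩
  rcases eq_or_ne z 0 with rfl | hz
  · simp [hN.zero]
  have hz0 : 0 < ‖z‖ := norm_pos_iff.2 hz
  have hu : ‖z‖⁻¹ • z ∈ Metric.sphere (0 : V n) 1 := by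
    simp [norm_smul, hz0.ne']
  have hNz : N z = ‖z‖ * N (‖z‖⁻¹ • z) := by
    rw [hN.smul, abs_of_pos (inv_pos.2 hz0)]
    field_simp
  have h1 : N a ≤ N (‖z‖⁻¹ • z) := hamin hu
  have h2 : N (‖z‖⁻¹ • z) ≤ N b := hbmax hu
  have h3 : ‖z‖ * N a ≤ N z := hNz ▸ mul_le_mul_of_nonneg_left h1 hz0.le
  have h4 : N z ≤ ‖z‖ * N b := hNz ▸ mul_le_mul_of_nonneg_left h2 hz0.le
  constructor
  · have : ‖z‖ ≤ (N a)⁻¹ * N z := by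
      rw [inv_mul_eq_div, le_div_iff₀ ha0]
      exact h3
    nlinarith [hN.nonneg z]
  · have : 0 ≤ (N a)⁻¹ * ‖z‖ := by positivity
    nlinarith

lemma IsNorm.intervalIntegrable_comp (hN : IsNorm N) {v : ℝ → V n} {a b : ℝ}
    (hv : IntervalIntegrable v volume a b) :
    IntervalIntegrable (fun s => N (v s)) volume a b := by
  obtain ⟨K, -, hK⟩ := hN.exists_equiv
  refine (hv.norm.const_mul K).mono_fun
    (hN.continuous.comp_aestronglyMeasurable hv.aestronglyMeasurable_restrict_uIoc) ?_
  refine Filter.Eventually.of_forall fun s => ?_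
  simp only [Real.norm_eq_abs, abs_of_nonneg (hN.nonneg _)]
  exact (hK _).2.trans (le_abs_self _)

lemma IsNorm.map_integral_le (hN : IsNorm N) {v : ℝ → V n} {a b : ℝ} (hab : a ≤ b)
    (hv : IntervalIntegrable v volume a b) :
    N (∫ s in a..b, v s) ≤ ∫ s in a..b, N (v s) := by
  rcases hab.eq_or_lt with rfl | hlt
  · simp [hN.zero]
  have hv' := (intervalIntegrable_iff_integrableOn_Ioc_of_le hab).1 hv
  have hNv := (intervalIntegrable_iff_integrableOn_Ioc_of_le hab).1 (hN.intervalIntegrable_comp hv)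
  have hJ := hN.convexOn.map_set_average_le hN.continuous.continuousOn isClosed_univ
    (μ := volume) (t := Ioc a b) (by simpa using hlt) (by simp) (by simp) hv' hNv
  have hpos : 0 < b - a := sub_pos.2 hlt
  rw [setAverage_eq, setAverage_eq, hN.smul, Real.volume_real_Ioc_of_le hab,
    abs_of_pos (inv_pos.2 hpos), smul_eq_mul] at hJ
  rw [intervalIntegral.integral_of_le hab, intervalIntegral.integral_of_le hab]
  exact le_of_mul_le_mul_left hJ (inv_pos.2 hpos)

end Norms

section Controls

variable {n : ℕ} {N : V n → ℝ}

/-- The endpoint at time `T` of the horizontal curve issued from the neutral element with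
horizontal velocity `v`. -/
def endpoint (T : ℝ) (v : ℝ → V n) : Heis n :=
  (∫ s in (0 : ℝ)..T, v s, ∫ s in (0 : ℝ)..T, 2 * symp (∫ u in (0 : ℝ)..s, v u) (v s))

/-- A horizontal curve of length `L` joins the neutral element to `p`. -/
def Reaches (N : V n → ℝ) (p : Heis n) (L : ℝ) : Prop :=
  ∃ (T : ℝ) (v : ℝ → V n), 0 ≤ T ∧ IntervalIntegrable v volume 0 T ∧ endpoint T v = p ∧
    L = ∫ s in (0 : ℝ)..T, N (v s)

lemma intervalIntegrable_coord {v : ℝ → V n} {a b : ℝ} (hv : IntervalIntegrable v volume a b)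
    (i : Fin (2 * n)) : IntervalIntegrable (fun s => v s i) volume a b :=
  ⟨(EuclideanSpace.proj i : V n →L[ℝ] ℝ).integrable_comp hv.1,
    (EuclideanSpace.proj i : V n →L[ℝ] ℝ).integrable_comp hv.2⟩

lemma intervalIntegrable_symp {z v : ℝ → V n} {a b : ℝ} (hz : ContinuousOn z (uIcc a b))
    (hv : IntervalIntegrable v volume a b) :
    IntervalIntegrable (fun s => 2 * symp (z s) (v s)) volume a b := by
  refine IntervalIntegrable.const_mul ?_ 2
  have hc : ∀ i, ContinuousOn (fun s => z s i) (uIcc a b) := fun i =>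
    (EuclideanSpace.proj i : V n →L[ℝ] ℝ).continuous.comp_continuousOn hz
  have hsum := IntervalIntegrable.sum (μ := volume) (a := a) (b := b) Finset.univ
    (f := fun (i : Fin n) s =>
      z s (sndIdx i) * v s (fstIdx i) - z s (fstIdx i) * v s (sndIdx i))
    fun i _ => ((intervalIntegrable_coord hv _).continuousOn_mul (hc _)).sub
      ((intervalIntegrable_coord hv _).continuousOn_mul (hc _))
  have heq : (fun s => symp (z s) (v s)) = ∑ i : Fin n, fun s =>
      z s (sndIdx i) * v s (fstIdx i) - z s (fstIdx i) * v s (sndIdx i) := by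
    ext s
    simp [symp]
  rwa [heq]

lemma integral_symp_const (c : V n) {v : ℝ → V n} {a b : ℝ}
    (hv : IntervalIntegrable v volume a b) :
    ∫ s in a..b, 2 * symp c (v s) = 2 * symp c (∫ s in a..b, v s) := by
  rw [intervalIntegral.integral_const_mul]
  congr 1
  exact (LinearMap.toContinuousLinearMap (sympL n c)).intervalIntegral_comp_comm hv

lemma continuousOn_primitive_left {v : ℝ → V n} {a b : ℝ}
    (hv : IntervalIntegrable v volume a b) :
    ContinuousOn (fun s => ∫ u in a..s, v u) (uIcc a b) :=
  intervalIntegral.continuousOn_primitive_interval' hv left_mem_uIcc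

/-- Vertical displacement of a curve with initial horizontal position `c`. -/
lemma integral_symp_add (c : V n) {v : ℝ → V n} {a b : ℝ}
    (hv : IntervalIntegrable v volume a b) :
    ∫ s in a..b, 2 * symp (c + ∫ u in a..s, v u) (v s) =
      2 * symp c (∫ s in a..b, v s) + ∫ s in a..b, 2 * symp (∫ u in a..s, v u) (v s) := by
  simp only [symp_add_left, mul_add]
  rw [intervalIntegral.integral_add
    (intervalIntegrable_symp (z := fun _ => c) continuousOn_const hv)
    (intervalIntegrable_symp (continuousOn_primitive_left hv) hv), integral_symp_const c hv]

/-- Translation of the time interval. -/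
lemma endpoint_comp_add (a b : ℝ) (v : ℝ → V n) :
    endpoint (b - a) (fun s => v (s + a)) =
      (∫ s in a..b, v s, ∫ s in a..b, 2 * symp (∫ u in a..s, v u) (v s)) := by
  have hs : ∀ s, ∫ u in (0 : ℝ)..s, v (u + a) = ∫ u in a..(s + a), v u := fun s => by
    rw [intervalIntegral.integral_comp_add_right, zero_add]
  unfold endpoint
  simp only [hs, sub_add_cancel]
  rw [intervalIntegral.integral_comp_add_right
    (fun s => 2 * symp (∫ u in a..s, v u) (v s)), zero_add, sub_add_cancel]

lemma HorizCurve.reaches {a b : ℝ} (c : HorizCurve n a b) (hab : a ≤ b) :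
    Reaches N (hmul (hinv (c.γ a)) (c.γ b)) (∫ s in a..b, N (c.v s)) := by
  have hv : IntervalIntegrable c.v volume a b :=
    (intervalIntegrable_iff_integrableOn_Icc_of_le hab).2 c.intg
  have hb : b ∈ Icc a b := ⟨hab, le_rfl⟩
  refine ⟨b - a, fun s => c.v (s + a), sub_nonneg.2 hab, ?_, ?_, ?_⟩
  · simpa using hv.comp_add_right a
  · have hvert : (c.γ b).2 = (c.γ a).2 +
        ∫ s in a..b, 2 * symp ((c.γ a).1 + ∫ u in a..s, c.v u) (c.v s) := by
      rw [c.vert b hb]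
      congr 1
      refine intervalIntegral.integral_congr fun s hs => ?_
      rw [uIcc_of_le hab] at hs
      simp only [← c.pos s hs]
    rw [integral_symp_add _ hv] at hvert
    rw [endpoint_comp_add]
    have hp := c.pos b hb
    refine Prod.ext ?_ ?_
    · simp [hmul, hinv, hp]
    · simp only [hmul, hinv, hvert, hp, symp_neg_left, symp_add_right, symp_self]
      ring
  · rw [intervalIntegral.integral_comp_add_right (fun s => N (c.v s)), zero_add, sub_add_cancel]

lemma Reaches.dSF_le (hN : IsNorm N) {p : Heis n} {L : ℝ} (h : Reaches N p L) (g : Heis n) :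
    dSF n N g (hmul g p) ≤ L := by
  obtain ⟨T, v, hT, hv, hp, rfl⟩ := h
  have hmono : ∀ s ∈ Icc 0 T, IntervalIntegrable v volume 0 s := fun s hs =>
    hv.mono_set (by rw [uIcc_of_le hs.1, uIcc_of_le hT]; exact Icc_subset_Icc_right hs.2)
  refine csInf_le ⟨0, ?_⟩ ⟨0, T, ⟨fun s => hmul g (endpoint s v), v, ?_, ?_, ?_⟩, hT, ?_, ?_, rfl⟩
  · rintro L ⟨a, b, c, hab, -, -, rfl⟩
    exact intervalIntegral.integral_nonneg hab fun s _ => hN.nonneg _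
  · exact (intervalIntegrable_iff_integrableOn_Icc_of_le hT).1 hv
  · intro s _
    simp [hmul, endpoint]
  · intro s hs
    simp only [hmul, endpoint, intervalIntegral.integral_same, symp_zero_right, mul_zero,
      add_zero, integral_symp_add _ (hmono s hs)]
    ring
  · simp [hmul, endpoint, symp_zero_right]
  · rw [← hp]

lemma reaches_horizontal (x : V n) : Reaches N (x, 0) (N x) := by
  refine ⟨1, fun _ => x, zero_le_one, intervalIntegrable_const, ?_, ?_⟩
  · simp [endpoint, symp_smul_left, symp_self]
  · simp

lemma Reaches.mul (hN : IsNorm N) {p q : Heis n} {L M : ℝ} (hp : Reaches N p L)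
    (hq : Reaches N q M) : Reaches N (hmul p q) (L + M) := by
  obtain ⟨T, v, hT, hv, rfl, rfl⟩ := hp
  obtain ⟨S, w, hS, hw, rfl, rfl⟩ := hq
  set f : ℝ → V n := fun s => if s ≤ T then v s else w (s - T) with hf
  have hf1 : ∀ s ≤ T, f s = v s := fun s hs => if_pos hs
  have hf2 : ∀ s, T < s → f s = w (s - T) := fun s hs => if_neg hs.not_ge
  have hTS : T ≤ T + S := le_add_of_nonneg_right hS
  have i1 : IntervalIntegrable f volume 0 T :=
    hv.congr_uIoo fun s hs => by
      rw [uIoo_of_le hT] at hs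
      exact (hf1 s hs.2.le).symm
  have i2 : IntervalIntegrable f volume T (T + S) := by
    have h := hw.comp_sub_right T
    rw [zero_add, add_comm S T] at h
    refine h.congr_uIoo fun s hs => ?_
    rw [uIoo_of_le hTS] at hs
    exact (hf2 s hs.1).symm
  have i3 := i1.trans i2
  have z1 : ∀ s, 0 ≤ s → s ≤ T → ∫ u in (0 : ℝ)..s, f u = ∫ u in (0 : ℝ)..s, v u := by
    intro s hs hsT
    refine intervalIntegral.integral_congr_uIoo fun u hu => ?_
    rw [uIoo_of_le hs] at hu
    exact hf1 u (hu.2.le.trans hsT)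
  have z2 : ∀ s, 0 ≤ s → ∫ u in T..(T + s), f u = ∫ u in (0 : ℝ)..s, w u := by
    intro s hs
    have h := intervalIntegral.integral_comp_sub_right (a := T) (b := T + s) w T
    rw [sub_self, add_sub_cancel_left] at h
    rw [← h]
    refine intervalIntegral.integral_congr_uIoo fun u hu => ?_
    rw [uIoo_of_le (le_add_of_nonneg_right hs)] at hu
    exact hf2 u hu.1
  refine ⟨T + S, f, by positivity, i3, ?_, ?_⟩
  · have hshift : endpoint S (fun s => f (s + T)) = endpoint S w := by
      have hz : ∀ s ∈ Ioo 0 S, ∫ u in (0 : ℝ)..s, f (u + T) = ∫ u in (0 : ℝ)..s, w u := by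
        intro s hs
        rw [intervalIntegral.integral_comp_add_right, zero_add, add_comm s T, z2 s hs.1.le]
      refine Prod.ext ?_ ?_
      · simp only [endpoint]
        rw [intervalIntegral.integral_comp_add_right, zero_add, add_comm S T, z2 S hS]
      · simp only [endpoint]
        refine intervalIntegral.integral_congr_uIoo fun s hs => ?_
        rw [uIoo_of_le hS] at hs
        simp only [hz s hs, hf2 (s + T) (by linarith [hs.1]), add_sub_cancel_right]
    have hw' : (∫ s in T..(T + S), f s, ∫ s in T..(T + S), 2 * symp (∫ u in T..s, f u) (f s)) =
        endpoint S w := by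
      rw [← hshift, ← endpoint_comp_add, add_sub_cancel_left]
    have hv' : endpoint T f = endpoint T v := by
      refine Prod.ext (z1 T hT le_rfl) ?_
      simp only [endpoint]
      refine intervalIntegral.integral_congr_uIoo fun s hs => ?_
      rw [uIoo_of_le hT] at hs
      simp only [z1 s hs.1.le hs.2.le, hf1 s hs.2.le]
    rw [← hv', ← hw']
    refine Prod.ext (intervalIntegral.integral_add_adjacent_intervals i1 i2).symm ?_
    have hcont := intervalIntegrable_symp (continuousOn_primitive_left i3) i3
    have hsub1 : uIcc 0 T ⊆ uIcc 0 (T + S) := by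
      rw [uIcc_of_le hT, uIcc_of_le (by positivity)]
      exact Icc_subset_Icc_right hTS
    have hsub2 : uIcc T (T + S) ⊆ uIcc 0 (T + S) := by
      rw [uIcc_of_le hTS, uIcc_of_le (by positivity)]
      exact Icc_subset_Icc_left hT
    have hsplit : ∫ s in T..(T + S), 2 * symp (∫ u in (0 : ℝ)..s, f u) (f s) =
        ∫ s in T..(T + S), 2 * symp ((∫ u in (0 : ℝ)..T, f u) + ∫ u in T..s, f u) (f s) := by
      refine intervalIntegral.integral_congr fun s hs => ?_
      rw [intervalIntegral.integral_add_adjacent_intervals i1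
        (i2.mono_set (uIcc_subset_uIcc left_mem_uIcc hs))]
    simp only [endpoint, hmul]
    rw [← intervalIntegral.integral_add_adjacent_intervals (hcont.mono_set hsub1)
      (hcont.mono_set hsub2), hsplit, integral_symp_add _ i2]
    ring
  · rw [← intervalIntegral.integral_add_adjacent_intervals (hN.intervalIntegrable_comp i1)
      (hN.intervalIntegrable_comp i2)]
    congr 1
    · refine intervalIntegral.integral_congr_uIoo fun s hs => ?_
      rw [uIoo_of_le hT] at hs
      simp only [hf1 s hs.2.le]
    · have h := intervalIntegral.integral_comp_sub_right (a := T) (b := T + S) (fun s => N (w s)) T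
      rw [sub_self, add_sub_cancel_left] at h
      rw [← h]
      refine intervalIntegral.integral_congr_uIoo fun s hs => ?_
      rw [uIoo_of_le hTS] at hs
      simp only [hf2 s hs.1]

lemma Reaches.norm_fst_le (hN : IsNorm N) {p : Heis n} {L : ℝ} (h : Reaches N p L) :
    N p.1 ≤ L := by
  obtain ⟨T, v, hT, hv, rfl, rfl⟩ := h
  exact hN.map_integral_le hT hv

/-- The vertical displacement is quadratically controlled by the length. -/
lemma exists_abs_snd_le (hN : IsNorm N) :
    ∃ C : ℝ, 0 ≤ C ∧ ∀ (p : Heis n) (L : ℝ), Reaches N p L → |p.2| ≤ C * L ^ 2 := by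
  obtain ⟨K, hK, hKN⟩ := hN.exists_equiv
  refine ⟨4 * n * K ^ 2, by positivity, ?_⟩
  rintro p L ⟨T, v, hT, hv, rfl, rfl⟩
  set L := ∫ s in (0 : ℝ)..T, N (v s) with hL
  have hNv := hN.intervalIntegrable_comp hv
  have hz : ∀ s ∈ Ioc 0 T, ‖∫ u in (0 : ℝ)..s, v u‖ ≤ K * L := by
    intro s hs
    have hsub : uIcc 0 s ⊆ uIcc 0 T := by
      rw [uIcc_of_le hs.1.le, uIcc_of_le hT]
      exact Icc_subset_Icc_right hs.2
    refine (hKN _).1.trans (mul_le_mul_of_nonneg_left ?_ hK.le)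
    refine (hN.map_integral_le hs.1.le (hv.mono_set hsub)).trans ?_
    exact intervalIntegral.integral_mono_interval le_rfl hs.1.le hs.2
      (Filter.Eventually.of_forall fun s => hN.nonneg _) hNv
  have hbound := intervalIntegral.norm_integral_le_of_norm_le (μ := volume) hT
    (f := fun s => 2 * symp (∫ u in (0 : ℝ)..s, v u) (v s))
    (g := fun s => 4 * n * K ^ 2 * L * N (v s))
    (Filter.Eventually.of_forall fun s hs => by
      have h1 := abs_symp_le (∫ u in (0 : ℝ)..s, v u) (v s)
      have h2 := mul_le_mul (hz s hs) (hKN (v s)).1 (norm_nonneg _)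
        ((norm_nonneg _).trans (hz s hs))
      have h3 := mul_le_mul_of_nonneg_left h2 (by positivity : (0 : ℝ) ≤ n)
      rw [Real.norm_eq_abs, abs_mul, abs_two]
      nlinarith) (hNv.const_mul _)
  rw [intervalIntegral.integral_const_mul (4 * n * K ^ 2 * L), ← hL] at hbound
  exact hbound.trans_eq (by ring)

end Controls

section Geodesics

variable {n : ℕ} {N : V n → ℝ} {γ : ℝ → Heis n}

lemma hmul_hinv_hmul (g g' : Heis n) : hmul g (hmul (hinv g) g') = g' := by
  refine Prod.ext ?_ ?_
  · simp [hmul, hinv]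
  · simp only [hmul, hinv, symp_neg_left, symp_add_right, symp_neg_right, symp_self]
    ring

/-- Two points at positive distance are joined by horizontal curves of almost minimal length. -/
lemma exists_reaches_lt {g g' : Heis n} {d ε : ℝ} (hd : dSF n N g g' = d) (h0 : 0 < d)
    (hε : 0 < ε) : ∃ L < d + ε, Reaches N (hmul (hinv g) g') L := by
  have hne : {L | ∃ (a b : ℝ) (c : HorizCurve n a b), a ≤ b ∧ c.γ a = g ∧ c.γ b = g' ∧
      L = ∫ s in a..b, N (c.v s)}.Nonempty := by
    by_contra h
    rw [dSF, not_nonempty_iff_eq_empty.1 h, Real.sInf_empty] at hd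
    exact h0.ne hd
  obtain ⟨L, ⟨a, b, c, hab, rfl, rfl, rfl⟩, hL⟩ :=
    exists_lt_of_csInf_lt hne (show dSF n N g g' < d + ε by linarith)
  exact ⟨_, hL, c.reaches hab⟩

lemma geodesic_norm_sub_le (hN : IsNorm N)
    (hgeo : ∀ s s' : ℝ, dSF n N (γ s) (γ s') = |s - s'|) {s s' : ℝ} (h : s < s') :
    N ((γ s').1 - (γ s).1) ≤ s' - s := by
  have hd : dSF n N (γ s) (γ s') = s' - s := by
    rw [hgeo, abs_sub_comm, abs_of_pos (sub_pos.2 h)]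
  refine le_of_forall_pos_lt_add fun ε hε => ?_
  obtain ⟨L, hL, hR⟩ := exists_reaches_lt hd (sub_pos.2 h) hε
  have := hR.norm_fst_le hN
  simp only [hmul, hinv, neg_add_eq_sub] at this
  linarith

/-- A geodesic whose horizontal projection is isometric for a strictly convex norm is a
horizontal line. -/
lemma exists_eq_line_of_norm_sub_eq (hN : IsNorm N) (hsc : StrictlyConvexNorm N)
    (hgeo : ∀ s s' : ℝ, dSF n N (γ s) (γ s') = |s - s'|)
    (hiso : ∀ s s' : ℝ, s < s' → N ((γ s').1 - (γ s).1) = s' - s) :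
    ∃ (g₀ : Heis n) (w : V n), ∀ s : ℝ, γ s = hmul g₀ (s • w, (0 : ℝ)) := by
  have hcol : ∀ s r q : ℝ, s < r → r < q →
      (r - s) • ((γ q).1 - (γ r).1) = (q - r) • ((γ r).1 - (γ s).1) := by
    intro s r q hsr hrq
    have h1 := hiso s r hsr
    have h2 := hiso r q hrq
    have hne : ∀ x : V n, 0 < N x → x ≠ 0 := by
      rintro x hx rfl
      exact hx.ne' hN.zero
    obtain ⟨α, hα, hx⟩ := hsc _ _ (hne _ (h1 ▸ sub_pos.2 hsr)) (hne _ (h2 ▸ sub_pos.2 hrq)) (by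
      rw [h1, h2, add_comm, sub_add_sub_cancel, hiso s q (hsr.trans hrq)]
      ring)
    rw [hx, hN.smul, h1, abs_of_pos hα] at h2
    rw [hx, smul_smul, ← h2, mul_comm α]
  set w := (γ 1).1 - (γ 0).1 with hw
  have hpos : ∀ s : ℝ, (γ s).1 = (γ 0).1 + s • w := by
    intro s
    rw [hw]
    rcases lt_trichotomy s 0 with h | rfl | h
    · linear_combination (norm := module) (1 : ℝ) • hcol s 0 1 h one_pos
    · simp
    rcases lt_trichotomy s 1 with h' | rfl | h'
    · linear_combination (norm := module) (-1 : ℝ) • hcol 0 s 1 h h'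
    · simp
    · linear_combination (norm := module) (1 : ℝ) • hcol 0 1 s one_pos h'
  obtain ⟨C, hC, hCR⟩ := exists_abs_snd_le hN
  set f : ℝ → ℝ := fun s => (γ s).2 - s * (2 * symp (γ 0).1 w) with hf
  have hlt : ∀ s s' : ℝ, s < s' → |f s' - f s| ≤ 4 * C * |s' - s| ^ 2 := by
    intro s s' h
    have hd : dSF n N (γ s) (γ s') = s' - s := by
      rw [hgeo, abs_sub_comm, abs_of_pos (sub_pos.2 h)]
    obtain ⟨L, hL, hR⟩ := exists_reaches_lt hd (sub_pos.2 h) (sub_pos.2 h)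
    have hL0 : 0 ≤ L := (hN.nonneg _).trans (hR.norm_fst_le hN)
    have h2 := hCR _ _ hR
    have heq : (hmul (hinv (γ s)) (γ s')).2 = f s' - f s := by
      simp only [hmul, hinv, hf, hpos s, hpos s', symp_neg_left, symp_add_left, symp_add_right,
        symp_smul_left, symp_smul_right, symp_self, symp_swap w (γ 0).1]
      ring
    rw [heq] at h2
    have h3 : L ^ 2 ≤ (2 * (s' - s)) ^ 2 := pow_le_pow_left₀ hL0 (by linarith) 2
    rw [sq_abs]
    nlinarith
  have hle : ∀ s s' : ℝ, |f s' - f s| ≤ 4 * C * |s' - s| ^ 2 := by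
    intro s s'
    rcases lt_trichotomy s s' with h | rfl | h
    · exact hlt s s' h
    · simp
    · rw [abs_sub_comm, abs_sub_comm s' s]
      exact hlt s' s h
  have hderiv : ∀ s, HasDerivAt f 0 s := by
    intro s
    have hO : (fun r => f r - f s) =O[nhds s] fun r => ‖r - s‖ ^ 2 :=
      Asymptotics.IsBigO.of_bound (4 * C) (Filter.Eventually.of_forall fun r => by
        simpa [Real.norm_eq_abs] using hle s r)
    have h := (hO.hasFDerivAt one_lt_two).hasDerivAt
    simpa using h.add_const (f s)
  refine ⟨γ 0, w, fun s => Prod.ext (hpos s) ?_⟩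
  have h := is_const_of_deriv_eq_zero (fun s => (hderiv s).differentiableAt)
    (fun s => (hderiv s).deriv) s 0
  simp only [hf, zero_mul] at h
  simp only [hmul, symp_smul_right]
  linarith

/-- A vertical displacement `τ` can be produced by conjugating a displacement over `y` with a
horizontal vector of norm at most `K |τ| / (4 ‖y‖)`. -/
lemma exists_symp_eq (hN : IsNorm N) {K : ℝ} (hK : ∀ z : V n, N z ≤ K * ‖z‖) {y : V n}
    (hy : y ≠ 0) (τ : ℝ) : ∃ η : V n, 4 * symp η y = τ ∧ 4 * ‖y‖ * N η ≤ K * |τ| := by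
  obtain ⟨e, he, hey⟩ := exists_symp_eq_norm_sq y
  have hy0 : 0 < ‖y‖ := norm_pos_iff.2 hy
  refine ⟨(τ / (4 * ‖y‖ ^ 2)) • e, ?_, ?_⟩
  · rw [symp_smul_left, hey]
    field_simp
  · have h := hK e
    rw [he] at h
    rw [hN.smul, abs_div, abs_of_pos (by positivity : 0 < 4 * ‖y‖ ^ 2)]
    calc 4 * ‖y‖ * (|τ| / (4 * ‖y‖ ^ 2) * N e)
        ≤ 4 * ‖y‖ * (|τ| / (4 * ‖y‖ ^ 2) * (K * ‖y‖)) := by gcongr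
      _ = K * |τ| := by field_simp

/-- If a detour saving length along a piece of a geodesic can be compensated by conjugating with
`η`, then `η` costs at least half of what is saved. -/
lemma saving_le_of_detour (hN : IsNorm N)
    (hgeo : ∀ s s' : ℝ, dSF n N (γ s) (γ s') = |s - s'|) {a b p q : ℝ} (hab : a < b)
    (hpq : p < q) {x η : V n} {L : ℝ}
    (hdetour : ∀ M, Reaches N (hmul (hinv (γ a)) (γ b)) M →
      Reaches N (hmul (hinv (γ p)) (γ q)) (N x + 2 * N η + M))
    (hL : (q - p) - (b - a) = L) : L ≤ N x + 2 * N η := by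
  have hd : dSF n N (γ a) (γ b) = b - a := by
    rw [hgeo, abs_sub_comm, abs_of_pos (sub_pos.2 hab)]
  refine le_of_forall_pos_lt_add fun ε hε => ?_
  obtain ⟨M, hM, hR⟩ := exists_reaches_lt hd (sub_pos.2 hab) hε
  have h := (hdetour M hR).dSF_le hN (γ p)
  rw [hmul_hinv_hmul, hgeo, abs_sub_comm, abs_of_pos (sub_pos.2 hpq)] at h
  linarith

/-- If a geodesic is not straight on `[α, β]`, its projection stays at bounded distance. -/
lemma norm_sub_le_of_saving (hN : IsNorm N)
    (hgeo : ∀ s s' : ℝ, dSF n N (γ s) (γ s') = |s - s'|) {K : ℝ}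
    (hK : ∀ z : V n, N z ≤ K * ‖z‖) {α β : ℝ} (hαβ : α < β)
    (hlt : N ((γ β).1 - (γ α).1) < β - α) :
    ∃ M : ℝ, 0 ≤ M ∧ (∀ s, β < s → ‖(γ s).1 - (γ β).1‖ ≤ M) ∧
      ∀ s, s < α → ‖(γ α).1 - (γ s).1‖ ≤ M := by
  set x := (γ β).1 - (γ α).1 with hx
  set τ := (hmul (hinv (γ α)) (γ β)).2 with hτ
  have hsave : 0 < 2 * (β - α - N x) := by linarith
  have hbound : ∀ y : V n, (∀ η : V n, 4 * symp η y = τ → β - α ≤ N x + 2 * N η) →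
      ‖y‖ ≤ |K| * |τ| / (2 * (β - α - N x)) := by
    intro y hy
    rcases eq_or_ne y 0 with rfl | hy0
    · rw [norm_zero]
      positivity
    obtain ⟨η, hη, hηN⟩ := exists_symp_eq hN hK hy0 τ
    rw [le_div_iff₀ hsave]
    have h1 := hy η hη
    have h2 : K * |τ| ≤ |K| * |τ| := by gcongr; exact le_abs_self K
    nlinarith [norm_nonneg y]
  refine ⟨|K| * |τ| / (2 * (β - α - N x)), by positivity, fun s hs => ?_, fun s hs => ?_⟩
  · refine hbound _ fun η hη => saving_le_of_detour hN hgeo hs (hαβ.trans hs) ?_ (by ring)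
    intro M hM
    have h := (((reaches_horizontal x).mul hN (reaches_horizontal η)).mul hN hM).mul hN
      (reaches_horizontal (-η))
    rw [hN.neg] at h
    convert h using 1
    · refine Prod.ext ?_ ?_
      · simp only [hmul, hinv, hx]
        abel
      · rw [hτ] at hη
        simp only [hmul, hinv, hx, symp_neg_left, symp_add_left, symp_add_right, symp_neg_right,
          symp_self, sub_eq_add_neg] at hη ⊢
        linarith [symp_swap η (γ s).1, symp_swap η (γ β).1, symp_swap η (γ α).1,
          symp_swap (γ α).1 (γ β).1]
    · ring
  · refine hbound _ fun η hη => saving_le_of_detour hN hgeo hs (hs.trans hαβ) ?_ (by ring)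
    intro M hM
    have h := (((reaches_horizontal η).mul hN hM).mul hN (reaches_horizontal (-η))).mul hN
      (reaches_horizontal x)
    rw [hN.neg] at h
    convert h using 1
    · refine Prod.ext ?_ ?_
      · simp only [hmul, hinv, hx]
        abel
      · rw [hτ] at hη
        simp only [hmul, hinv, hx, symp_neg_left, symp_add_left, symp_add_right, symp_neg_right,
          symp_self, sub_eq_add_neg] at hη ⊢
        linarith [symp_swap η (γ s).1, symp_swap η (γ β).1, symp_swap η (γ α).1,
          symp_swap (γ α).1 (γ β).1]
    · ring

end Geodesics

/-- If `N` is strictly convex (possibly non-smooth) and `γ : ℝ → ℍⁿ`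
is an infinite geodesic for `d_SF` which is not a horizontal line, then its horizontal
projection is bounded in the Euclidean norm. -/
theorem stmt18 (n : ℕ) (N : V n → ℝ) (hN : IsNorm N) (hsc : StrictlyConvexNorm N)
    (γ : ℝ → Heis n) (hgeo : ∀ s s' : ℝ, dSF n N (γ s) (γ s') = |s - s'|)
    (hline : ¬ ∃ (g₀ : Heis n) (w : V n), ∀ s : ℝ, γ s = hmul g₀ (s • w, (0 : ℝ))) :
    ∃ C : ℝ, 0 < C ∧ ∀ s : ℝ, ‖(γ s).1‖ ≤ C := by
  have hne := mt (exists_eq_line_of_norm_sub_eq hN hsc hgeo) hline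
  push Not at hne
  obtain ⟨α, β, hαβ, hneq⟩ := hne
  have hlt := (geodesic_norm_sub_le hN hgeo hαβ).lt_of_ne hneq
  obtain ⟨K, hK, hKN⟩ := hN.exists_equiv
  obtain ⟨M, hM, hright, hleft⟩ :=
    norm_sub_le_of_saving hN hgeo (fun z => (hKN z).2) hαβ hlt
  have hmid : ∀ s, α < s → s ≤ β → ‖(γ s).1 - (γ α).1‖ ≤ K * (β - α) := fun s h1 h2 =>
    (hKN _).1.trans (mul_le_mul_of_nonneg_left
      ((geodesic_norm_sub_le hN hgeo h1).trans (by linarith)) hK.le)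
  have hKab : 0 < K * (β - α) := mul_pos hK (sub_pos.2 hαβ)
  have hα := norm_nonneg (γ α).1
  have hβ := norm_nonneg (γ β).1
  refine ⟨‖(γ α).1‖ + ‖(γ β).1‖ + M + K * (β - α), by positivity, fun s => ?_⟩
  rcases lt_trichotomy s α with h | rfl | h
  · have h1 := norm_sub_norm_le (γ s).1 (γ α).1
    rw [norm_sub_rev] at h1
    linarith [hleft s h]
  · linarith
  rcases le_or_gt s β with h' | h'
  · linarith [norm_sub_norm_le (γ s).1 (γ α).1, hmid s h h']
  · linarith [norm_sub_norm_le (γ s).1 (γ β).1, hright s h']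

end
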